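/- arXiv:math/0503442 — 2 statements merged into one kernel-verified Lean document; each statement's English description precedes it below -/
import Mathlib

section
/- Let y₁,…,y_d be fixed vectors in ℝᵏ and ε₁,…,ε_d independent symmetric ±1-valued (Rademacher) random variables. Then for every p ≥ 1, (E‖∑_{i=1}^d ε_i y_i ⊗ y_i‖₂^p)^{1/p} ≤ C₀ (p + log k)^{1/2} · max_{i≤d} ‖y_i‖₂ · ‖∑_{i=1}^d y_i ⊗ y_i‖₂^{1/2}, where C₀ is an absolute constant. -/
open scoped Classical
noncomputable section

/-- Spectral (ℓ₂→ℓ₂ operator) norm of a real matrix. -/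
def spec {m n : ℕ} (A : Matrix (Fin m) (Fin n) ℝ) : ℝ :=
  ‖LinearMap.toContinuousLinearMap (Matrix.toEuclideanLin A)‖

open Matrix in
lemma rud_spectral {k : ℕ} (X : Matrix (Fin k) (Fin k) ℝ) (hX : Xᵀ = X) :
    ∃ (l : Fin k → ℝ) (U : Matrix (Fin k) (Fin k) ℝ), U * Uᵀ = 1 ∧ Uᵀ * U = 1 ∧
      ∀ n : ℕ, X ^ n = U * diagonal (fun j => l j ^ n) * Uᵀ := by
  have h : X.IsHermitian := by
    rw [Matrix.IsHermitian, Matrix.conjTranspose_eq_transpose_of_trivial]; exact hX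
  obtain ⟨l, U, h1, h2, h3⟩ : ∃ (l : Fin k → ℝ) (U : Matrix (Fin k) (Fin k) ℝ),
      U * Uᵀ = 1 ∧ Uᵀ * U = 1 ∧ X = U * diagonal l * Uᵀ := by
    refine ⟨h.eigenvalues, (h.eigenvectorUnitary : Matrix (Fin k) (Fin k) ℝ), ?_, ?_, ?_⟩
    · have := (Matrix.mem_unitaryGroup_iff).1 h.eigenvectorUnitary.2
      rwa [Matrix.star_eq_conjTranspose, Matrix.conjTranspose_eq_transpose_of_trivial] at this
    · have := (Matrix.mem_unitaryGroup_iff').1 h.eigenvectorUnitary.2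
      rwa [Matrix.star_eq_conjTranspose, Matrix.conjTranspose_eq_transpose_of_trivial] at this
    · have := h.spectral_theorem
      rw [Unitary.conjStarAlgAut_apply, Matrix.star_eq_conjTranspose,
        Matrix.conjTranspose_eq_transpose_of_trivial] at this
      exact this
  refine ⟨l, U, h1, h2, fun n => ?_⟩
  induction n with
  | zero => simp [h1]
  | succ n ih =>
    rw [pow_succ, ih]
    conv_lhs => rw [h3]
    have : U * diagonal (fun j => l j ^ n) * Uᵀ * (U * diagonal l * Uᵀ)
      = U * diagonal (fun j => l j ^ n) * (Uᵀ * U) * diagonal l * Uᵀ := by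
      simp only [Matrix.mul_assoc]
    rw [this, h2, Matrix.mul_one, Matrix.mul_assoc U, Matrix.diagonal_mul_diagonal]
    simp [pow_succ]

open Matrix in
lemma rud_quad {k : ℕ} (U : Matrix (Fin k) (Fin k) ℝ) (l : Fin k → ℝ) (y : Fin k → ℝ) :
    y ⬝ᵥ ((U * diagonal l * Uᵀ) *ᵥ y) = ∑ j, l j * ((Uᵀ *ᵥ y) j) ^ 2 := by
  rw [← Matrix.mulVec_mulVec, ← Matrix.mulVec_mulVec, Matrix.dotProduct_mulVec,
    ← Matrix.mulVec_transpose]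
  simp only [dotProduct, Matrix.mulVec_diagonal]
  exact Finset.sum_congr rfl fun j _ => by ring

open Matrix in
lemma rud_trace {k : ℕ} (U : Matrix (Fin k) (Fin k) ℝ) (l : Fin k → ℝ) (h : Uᵀ * U = 1) :
    (U * diagonal l * Uᵀ).trace = ∑ j, l j := by
  rw [Matrix.trace_mul_comm, ← Matrix.mul_assoc, h, Matrix.one_mul, Matrix.trace_diagonal]

lemma rud_scalar1 (a b : ℝ) (ha : 0 ≤ a) (hb : 0 ≤ b) (q r : ℕ) :
    a ^ q * b ^ r + a ^ r * b ^ q ≤ a ^ (q + r) + b ^ (q + r) := by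
  rw [pow_add, pow_add]
  rcases le_total a b with h | h
  · nlinarith [mul_nonneg (sub_nonneg.2 (pow_le_pow_left₀ ha h q))
      (sub_nonneg.2 (pow_le_pow_left₀ ha h r))]
  · nlinarith [mul_nonneg (sub_nonneg.2 (pow_le_pow_left₀ hb h q))
      (sub_nonneg.2 (pow_le_pow_left₀ hb h r))]

lemma rud_scalar (a b : ℝ) (n : ℕ) (hn : Even n) :
    ∑ q ∈ Finset.range (n + 1), a ^ q * b ^ (n - q) ≤ (n + 1) / 2 * (a ^ n + b ^ n) := by
  have h2 : ∑ q ∈ Finset.range (n + 1), a ^ q * b ^ (n - q)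
      = ∑ q ∈ Finset.range (n + 1), a ^ (n - q) * b ^ q := by
    rw [← Finset.sum_range_reflect]
    refine Finset.sum_congr rfl fun q hq => ?_
    have := Finset.mem_range.1 hq
    congr 2 <;> omega
  have h3 : ∑ q ∈ Finset.range (n + 1), (a ^ q * b ^ (n - q) + a ^ (n - q) * b ^ q)
      ≤ ∑ q ∈ Finset.range (n + 1), (a ^ n + b ^ n) := by
    refine Finset.sum_le_sum fun q hq => ?_
    have hq := Finset.mem_range.1 hq
    have := rud_scalar1 |a| |b| (abs_nonneg _) (abs_nonneg _) q (n - q)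
    rw [show q + (n - q) = n by omega, hn.pow_abs, hn.pow_abs] at this
    refine le_trans (add_le_add ?_ ?_) this
    · rw [← abs_pow, ← abs_pow, ← abs_mul]; exact le_abs_self _
    · rw [← abs_pow, ← abs_pow, ← abs_mul]; exact le_abs_self _
  rw [Finset.sum_add_distrib, ← h2, Finset.sum_const, Finset.card_range, nsmul_eq_mul] at h3
  push_cast at h3
  linarith

open Matrix in
lemma rud_pair {k : ℕ} (X Y : Matrix (Fin k) (Fin k) ℝ) (hX : Xᵀ = X) (hY : Yᵀ = Y)
    (y : Fin k → ℝ) (n : ℕ) (hn : Even n) :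
    ∑ q ∈ Finset.range (n + 1), (y ⬝ᵥ (X ^ q *ᵥ y)) * (y ⬝ᵥ (Y ^ (n - q) *ᵥ y))
      ≤ (n + 1) / 2 * (y ⬝ᵥ y) * (y ⬝ᵥ (X ^ n *ᵥ y) + y ⬝ᵥ (Y ^ n *ᵥ y)) := by
  obtain ⟨l, U, hU, -, hl⟩ := rud_spectral X hX
  obtain ⟨m, V, hV, -, hm⟩ := rud_spectral Y hY
  have e1 : y ⬝ᵥ y = ∑ j, ((Uᵀ *ᵥ y) j) ^ 2 := by
    have := rud_quad U (fun _ => 1) y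
    rw [Matrix.diagonal_one, Matrix.mul_one, hU] at this
    simpa using this
  have e2 : y ⬝ᵥ y = ∑ j, ((Vᵀ *ᵥ y) j) ^ 2 := by
    have := rud_quad V (fun _ => 1) y
    rw [Matrix.diagonal_one, Matrix.mul_one, hV] at this
    simpa using this
  have e3 : (n + 1) / 2 * (y ⬝ᵥ y) * (y ⬝ᵥ (X ^ n *ᵥ y) + y ⬝ᵥ (Y ^ n *ᵥ y))
      = (n + 1) / 2 * ((y ⬝ᵥ (X ^ n *ᵥ y)) * (y ⬝ᵥ y) + (y ⬝ᵥ y) * (y ⬝ᵥ (Y ^ n *ᵥ y))) := by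
    ring
  rw [e3]
  conv_rhs => enter [2, 1, 2]; rw [e2]
  conv_rhs => enter [2, 2, 1]; rw [e1]
  simp only [hl, hm, rud_quad]
  simp only [Finset.sum_mul_sum]
  rw [Finset.sum_comm, ← Finset.sum_add_distrib, Finset.mul_sum]
  refine Finset.sum_le_sum fun i _ => ?_
  rw [Finset.sum_comm, ← Finset.sum_add_distrib, Finset.mul_sum]
  refine Finset.sum_le_sum fun j _ => ?_
  have := mul_le_mul_of_nonneg_right (rud_scalar (l i) (m j) n hn)
    (mul_nonneg (sq_nonneg ((Uᵀ *ᵥ y) i)) (sq_nonneg ((Vᵀ *ᵥ y) j)))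
  rw [Finset.sum_mul] at this
  refine le_trans (le_of_eq ?_) (this.trans (le_of_eq ?_))
  · exact Finset.sum_congr rfl fun q _ => by ring
  · ring

lemma rud_telescope {k : ℕ} (X Y : Matrix (Fin k) (Fin k) ℝ) (n : ℕ) :
    X ^ n - Y ^ n = ∑ q ∈ Finset.range n, X ^ q * (X - Y) * Y ^ (n - 1 - q) := by
  induction n with
  | zero => simp
  | succ n ih =>
    have h : X ^ (n + 1) - Y ^ (n + 1) = (X ^ n - Y ^ n) * Y + X ^ n * (X - Y) := by
      rw [pow_succ, pow_succ]; noncomm_ring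
    rw [h, ih, Finset.sum_range_succ, Finset.sum_mul]
    simp only [Nat.add_sub_cancel, Nat.sub_self, pow_zero, mul_one]
    congr 1
    refine Finset.sum_congr rfl fun q hq => ?_
    have := Finset.mem_range.1 hq
    rw [mul_assoc, ← pow_succ, show n - 1 - q + 1 = n - q by omega]

open Matrix in
lemma rud_diff {k : ℕ} (X Y : Matrix (Fin k) (Fin k) ℝ) (y : Fin k → ℝ) (c : ℝ)
    (h : X - Y = c • vecMulVec y y) (n : ℕ) :
    y ⬝ᵥ (X ^ (n + 1) *ᵥ y) - y ⬝ᵥ (Y ^ (n + 1) *ᵥ y) =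
      c * ∑ q ∈ Finset.range (n + 1), (y ⬝ᵥ (X ^ q *ᵥ y)) * (y ⬝ᵥ (Y ^ (n - q) *ᵥ y)) := by
  rw [← dotProduct_sub, ← Matrix.sub_mulVec, rud_telescope, h, Matrix.sum_mulVec,
    dotProduct_sum, Finset.mul_sum]
  refine Finset.sum_congr rfl fun q _ => ?_
  rw [Nat.add_sub_cancel, ← Matrix.mulVec_mulVec, ← Matrix.mulVec_mulVec, Matrix.smul_mulVec,
    Matrix.vecMulVec_mulVec, Matrix.mulVec_smul]
  simp only [Matrix.smul_mulVec, Matrix.mulVec_smul, dotProduct_smul, smul_eq_mul, op_smul_eq_smul]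
  ring

/-- the sign. -/
def rudEps (b : Bool) : ℝ := if b then 1 else -1

/-- the random matrix. -/
def rudX {k d : ℕ} (y : Fin d → Fin k → ℝ) (s : Fin d → Bool) : Matrix (Fin k) (Fin k) ℝ :=
  ∑ i : Fin d, rudEps (s i) • Matrix.vecMulVec (y i) (y i)

open Matrix in
lemma rudX_symm {k d : ℕ} (y : Fin d → Fin k → ℝ) (s : Fin d → Bool) :
    (rudX y s)ᵀ = rudX y s := by
  simp [rudX, Matrix.transpose_sum, Matrix.transpose_vecMulVec]

/-- flip one sign. -/
def rudFlip {d : ℕ} (i : Fin d) (s : Fin d → Bool) : Fin d → Bool :=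
  Function.update s i (!(s i))

lemma rudFlip_invol {d : ℕ} (i : Fin d) : Function.Involutive (rudFlip i) := by
  intro s
  simp [rudFlip]

lemma rudX_flip {k d : ℕ} (y : Fin d → Fin k → ℝ) (s : Fin d → Bool) (i : Fin d) :
    rudX y s - rudX y (rudFlip i s) = (2 * rudEps (s i)) • Matrix.vecMulVec (y i) (y i) := by
  rw [rudX, rudX, ← Finset.sum_sub_distrib, Finset.sum_eq_single i]
  · rw [← sub_smul]
    congr 1
    cases h : s i <;> norm_num [rudEps, rudFlip, h]
  · intro j _ hj
    simp [rudFlip, Function.update_of_ne hj]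
  · simp

lemma rudEps_flip {d : ℕ} (s : Fin d → Bool) (i : Fin d) :
    rudEps (rudFlip i s i) = - rudEps (s i) := by
  cases h : s i <;> norm_num [rudEps, rudFlip, h]

lemma rudEps_sq (b : Bool) : rudEps b * rudEps b = 1 := by
  cases b <;> norm_num [rudEps]

lemma rud_sum_flip {d : ℕ} (i : Fin d) (f : (Fin d → Bool) → ℝ) :
    ∑ s, f (rudFlip i s) = ∑ s, f s :=
  Equiv.sum_comp (rudFlip_invol i).toPerm f

open Matrix in
lemma rud_step1 {k d : ℕ} (y : Fin d → Fin k → ℝ) (i : Fin d) (n : ℕ) (hn : Even n) :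
    ∑ s, rudEps (s i) * (y i ⬝ᵥ (rudX y s ^ (n + 1) *ᵥ y i))
      ≤ (n + 1) * (y i ⬝ᵥ y i) * ∑ s, y i ⬝ᵥ (rudX y s ^ n *ᵥ y i) := by
  have h1 : 2 * ∑ s, rudEps (s i) * (y i ⬝ᵥ (rudX y s ^ (n + 1) *ᵥ y i))
      = ∑ s, rudEps (s i) * (y i ⬝ᵥ (rudX y s ^ (n + 1) *ᵥ y i)
          - y i ⬝ᵥ (rudX y (rudFlip i s) ^ (n + 1) *ᵥ y i)) := by
    have := rud_sum_flip i (fun s => rudEps (s i) * (y i ⬝ᵥ (rudX y s ^ (n + 1) *ᵥ y i)))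
    simp only [rudEps_flip, neg_mul, Finset.sum_neg_distrib] at this
    simp only [mul_sub, Finset.sum_sub_distrib]
    linarith
  have h2 := rud_sum_flip i (fun s => (y i ⬝ᵥ (rudX y s ^ n *ᵥ y i)))
  have h3 : ∑ s, rudEps (s i) * (y i ⬝ᵥ (rudX y s ^ (n + 1) *ᵥ y i)
          - y i ⬝ᵥ (rudX y (rudFlip i s) ^ (n + 1) *ᵥ y i))
      ≤ ∑ s, (n + 1) * (y i ⬝ᵥ y i) * (y i ⬝ᵥ (rudX y s ^ n *ᵥ y i)
          + y i ⬝ᵥ (rudX y (rudFlip i s) ^ n *ᵥ y i)) := by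
    refine Finset.sum_le_sum fun s _ => ?_
    rw [rud_diff _ _ _ _ (rudX_flip y s i) n]
    have := rud_pair _ _ (rudX_symm y s) (rudX_symm y (rudFlip i s)) (y i) n hn
    rw [← mul_assoc, show rudEps (s i) * (2 * rudEps (s i)) = 2 by
      have := rudEps_sq (s i); linarith]
    linarith
  rw [← Finset.mul_sum, Finset.sum_add_distrib, h2] at h3
  linarith

lemma rud_spec_le {k : ℕ} (A : Matrix (Fin k) (Fin k) ℝ) (L : ℝ) (hL : 0 ≤ L)
    (h : ∀ v : Fin k → ℝ, dotProduct (A.mulVec v) (A.mulVec v) ≤ L ^ 2 * dotProduct v v) :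
    spec A ≤ L := by
  refine ContinuousLinearMap.opNorm_le_bound _ hL fun v => ?_
  refine le_of_sq_le_sq ?_ (by positivity)
  have := h v.ofLp
  rw [mul_pow, EuclideanSpace.real_norm_sq_eq, EuclideanSpace.real_norm_sq_eq]
  simpa [dotProduct, sq] using this

lemma rud_quad_le_spec {k : ℕ} (A : Matrix (Fin k) (Fin k) ℝ) (v : Fin k → ℝ) :
    dotProduct v (A.mulVec v) ≤ spec A * dotProduct v v := by
  have h1 := real_inner_le_norm (WithLp.toLp 2 v)
    (LinearMap.toContinuousLinearMap (Matrix.toEuclideanLin A) (WithLp.toLp 2 v))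
  have h2 := ContinuousLinearMap.le_opNorm
    (LinearMap.toContinuousLinearMap (Matrix.toEuclideanLin A)) (WithLp.toLp 2 v)
  have h3 : ‖WithLp.toLp 2 v‖ * ‖WithLp.toLp 2 v‖ = dotProduct v v := by
    rw [← sq, EuclideanSpace.real_norm_sq_eq]; simp [dotProduct, sq]
  have h4 : inner ℝ (WithLp.toLp 2 v)
    (LinearMap.toContinuousLinearMap (Matrix.toEuclideanLin A) (WithLp.toLp 2 v))
      = dotProduct v (A.mulVec v) := by
    simp [EuclideanSpace.inner_eq_star_dotProduct, dotProduct_comm]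
  rw [h4] at h1
  have h5 := mul_le_mul_of_nonneg_left h2 (norm_nonneg (WithLp.toLp 2 v))
  unfold spec
  rw [← h3]
  nlinarith

open Matrix in
lemma rud_trace_nonneg {k : ℕ} (X : Matrix (Fin k) (Fin k) ℝ) (hX : Xᵀ = X) (m : ℕ) :
    0 ≤ (X ^ (2 * m)).trace := by
  obtain ⟨l, U, hU, hU', hl⟩ := rud_spectral X hX
  rw [hl, rud_trace _ _ hU']
  exact Finset.sum_nonneg fun j _ => by rw [pow_mul]; positivity

open Matrix in
lemma rud_spec_pow {k : ℕ} (X : Matrix (Fin k) (Fin k) ℝ) (hX : Xᵀ = X) (m : ℕ) (hm : 1 ≤ m) :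
    spec X ^ (2 * m) ≤ (X ^ (2 * m)).trace := by
  obtain ⟨l, U, hU, hU', hl⟩ := rud_spectral X hX
  have hs : spec X ≤ ‖l‖ := by
    refine rud_spec_le X _ (norm_nonneg _) fun v => ?_
    have e1 : v ⬝ᵥ v = ∑ j, ((Uᵀ *ᵥ v) j) ^ 2 := by
      have := rud_quad U (fun _ => 1) v
      rw [Matrix.diagonal_one, Matrix.mul_one, hU] at this
      simpa using this
    have e2 : (X *ᵥ v) ⬝ᵥ (X *ᵥ v) = v ⬝ᵥ (X ^ 2 *ᵥ v) := by
      rw [sq, ← Matrix.mulVec_mulVec, Matrix.dotProduct_mulVec v, ← Matrix.mulVec_transpose, hX]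
    rw [e2, hl, rud_quad, e1, Finset.mul_sum]
    refine Finset.sum_le_sum fun j _ => mul_le_mul_of_nonneg_right ?_ (sq_nonneg _)
    have := norm_le_pi_norm l j
    rw [← sq_abs (l j)]
    exact pow_le_pow_left₀ (abs_nonneg _) this 2
  have hs0 : 0 ≤ spec X := norm_nonneg _
  refine (pow_le_pow_left₀ hs0 hs _).trans ?_
  rw [hl, rud_trace _ _ hU']
  rcases isEmpty_or_nonempty (Fin k) with he | he
  · have : l = 0 := Subsingleton.elim _ _
    rw [this, norm_zero, zero_pow (by omega)]
    simp
  · obtain ⟨j, hj⟩ := (Finite.exists_max (fun j => ‖l j‖))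
    have : ‖l‖ ≤ ‖l j‖ := (pi_norm_le_iff_of_nonneg (norm_nonneg _)).2 hj
    refine (pow_le_pow_left₀ (norm_nonneg _) this _).trans ?_
    rw [Real.norm_eq_abs, (even_two_mul m).pow_abs]
    exact Finset.single_le_sum (f := fun j => l j ^ (2 * m))
      (fun j _ => by rw [pow_mul]; positivity) (Finset.mem_univ j)

open Matrix in
lemma rud_S {k d : ℕ} (y : Fin d → Fin k → ℝ) (X : Matrix (Fin k) (Fin k) ℝ) (hX : Xᵀ = X)
    (m : ℕ) :
    ∑ i, y i ⬝ᵥ (X ^ (2 * m) *ᵥ y i)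
      ≤ spec (∑ i : Fin d, vecMulVec (y i) (y i)) * (X ^ (2 * m)).trace := by
  obtain ⟨l, U, hU, hU', hl⟩ := rud_spectral X hX
  rw [hl, rud_trace _ _ hU']
  simp only [rud_quad]
  rw [Finset.sum_comm, Finset.mul_sum]
  refine Finset.sum_le_sum fun j _ => ?_
  rw [← Finset.mul_sum, mul_comm]
  refine mul_le_mul_of_nonneg_right ?_ (by rw [pow_mul]; positivity)
  have h := rud_quad_le_spec (∑ i : Fin d, vecMulVec (y i) (y i)) (Uᵀ j)
  have h1 : Uᵀ j ⬝ᵥ Uᵀ j = 1 := by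
    have := congrFun (congrFun hU' j) j
    rw [Matrix.one_apply_eq, Matrix.mul_apply] at this
    simpa [dotProduct] using this
  rw [h1, mul_one] at h
  refine le_trans (le_of_eq ?_) h
  rw [Matrix.sum_mulVec, dotProduct_sum]
  refine Finset.sum_congr rfl fun i _ => ?_
  rw [Matrix.vecMulVec_mulVec]
  simp only [Matrix.mulVec, sq, dotProduct_comm (y i) (Uᵀ j)]
  simp
  rfl

open Matrix in
lemma rud_step {k d : ℕ} (y : Fin d → Fin k → ℝ) (M : ℝ) (hM : ∀ i, y i ⬝ᵥ y i ≤ M ^ 2)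
    (m : ℕ) :
    ∑ s, (rudX y s ^ (2 * (m + 1))).trace ≤
      (2 * m + 1) * (M ^ 2 * spec (∑ i : Fin d, vecMulVec (y i) (y i))) *
        ∑ s, (rudX y s ^ (2 * m)).trace := by
  have h0 : ∀ s, (rudX y s ^ (2 * (m + 1))).trace
      = ∑ i, rudEps (s i) * (y i ⬝ᵥ (rudX y s ^ (2 * m + 1) *ᵥ y i)) := by
    intro s
    rw [show 2 * (m + 1) = (2 * m + 1) + 1 by ring, pow_succ]
    conv_lhs => enter [1, 2]; rw [rudX]
    rw [Matrix.mul_sum, Matrix.trace_sum]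
    refine Finset.sum_congr rfl fun i _ => ?_
    rw [Matrix.mul_smul, Matrix.trace_smul, Matrix.mul_vecMulVec, Matrix.trace_vecMulVec,
      dotProduct_comm, smul_eq_mul]
  simp only [h0]
  rw [Finset.sum_comm]
  have hq : ∀ s i, 0 ≤ y i ⬝ᵥ (rudX y s ^ (2 * m) *ᵥ y i) := by
    intro s i
    obtain ⟨l, U, hU, hU', hl⟩ := rud_spectral _ (rudX_symm y s)
    rw [hl, rud_quad]
    exact Finset.sum_nonneg fun j _ => by rw [pow_mul]; positivity
  calc _ ≤ ∑ i, (2 * m + 1) * M ^ 2 * ∑ s, y i ⬝ᵥ (rudX y s ^ (2 * m) *ᵥ y i) := by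
        refine Finset.sum_le_sum fun i _ => ?_
        refine (rud_step1 y i (2 * m) (even_two_mul m)).trans ?_
        push_cast
        refine mul_le_mul_of_nonneg_right ?_ (Finset.sum_nonneg fun s _ => hq s i)
        exact mul_le_mul_of_nonneg_left (hM i) (by positivity)
    _ = (2 * m + 1) * M ^ 2 * ∑ s, ∑ i, y i ⬝ᵥ (rudX y s ^ (2 * m) *ᵥ y i) := by
        rw [← Finset.mul_sum, Finset.sum_comm]
    _ ≤ (2 * m + 1) * M ^ 2 * ∑ s, spec (∑ i : Fin d, vecMulVec (y i) (y i)) *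
          (rudX y s ^ (2 * m)).trace := by
        refine mul_le_mul_of_nonneg_left ?_ (by positivity)
        exact Finset.sum_le_sum fun s _ => rud_S y _ (rudX_symm y s) m
    _ = _ := by rw [← Finset.mul_sum]; ring

open Matrix in
lemma rud_moment {k d : ℕ} (y : Fin d → Fin k → ℝ) (M : ℝ) (hM : ∀ i, y i ⬝ᵥ y i ≤ M ^ 2)
    (N : ℕ) (m : ℕ) (hm : m ≤ N) :
    ∑ s, (rudX y s ^ (2 * m)).trace ≤ 2 ^ d * k *
      (2 * N * (M ^ 2 * spec (∑ i : Fin d, vecMulVec (y i) (y i)))) ^ m := by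
  have hs : 0 ≤ spec (∑ i : Fin d, vecMulVec (y i) (y i)) := norm_nonneg _
  induction m with
  | zero => simp
  | succ m ih =>
    refine (rud_step y M hM m).trans ?_
    have h1 : (2 * m + 1 : ℝ) ≤ 2 * N := by
      have : 2 * m + 1 ≤ 2 * N := by omega
      exact_mod_cast this
    have h2 := ih (by omega)
    have h3 : 0 ≤ ∑ s, (rudX y s ^ (2 * m)).trace :=
      Finset.sum_nonneg fun s _ => rud_trace_nonneg _ (rudX_symm y s) m
    calc _ ≤ (2 * N * (M ^ 2 * spec (∑ i : Fin d, vecMulVec (y i) (y i)))) *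
          ∑ s, (rudX y s ^ (2 * m)).trace := by gcongr
      _ ≤ (2 * N * (M ^ 2 * spec (∑ i : Fin d, vecMulVec (y i) (y i)))) * _ :=
          mul_le_mul_of_nonneg_left h2 (by positivity)
      _ = _ := by rw [pow_succ]; ring

lemma rud_jensen {ι : Type*} [Fintype ι] [Nonempty ι] (z : ι → ℝ) (hz : ∀ i, 0 ≤ z i) (c : ℝ)
    (hc : c = (Fintype.card ι : ℝ)) (p r : ℝ) (hp : 0 < p) (hpr : p ≤ r) :
    (c⁻¹ * ∑ i, z i ^ p) ^ (1 / p) ≤ (c⁻¹ * ∑ i, z i ^ r) ^ (1 / r) := by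
  have hc0 : 0 < c := by rw [hc]; exact_mod_cast Fintype.card_pos
  have h := Real.rpow_arith_mean_le_arith_mean_rpow Finset.univ (fun _ : ι => c⁻¹)
    (fun i => z i ^ p) (fun _ _ => by positivity)
    (by simp [← hc]; field_simp) (fun i _ => Real.rpow_nonneg (hz i) p)
    (p := r / p) (by rw [le_div_iff₀ hp]; linarith)
  simp only [← Finset.mul_sum] at h
  have hr : 0 < r := by linarith
  have e : ∀ i, (z i ^ p) ^ (r / p) = z i ^ r := fun i => by
    rw [← Real.rpow_mul (hz i)]; congr 1; field_simp
  simp only [e] at h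
  have h0 : 0 ≤ c⁻¹ * ∑ i, z i ^ p :=
    mul_nonneg (by positivity) (Finset.sum_nonneg fun i _ => Real.rpow_nonneg (hz i) p)
  have := Real.rpow_le_rpow (Real.rpow_nonneg h0 _) h (z := 1 / r) (by positivity)
  rw [← Real.rpow_mul h0] at this
  convert this using 2
  field_simp

theorem rudelson_lemma :
    ∃ C₀ : ℝ, 0 < C₀ ∧
      ∀ (k d : ℕ) (y : Fin d → Fin k → ℝ) (p : ℝ), 1 ≤ p →
        (((2 : ℝ) ^ d)⁻¹ *
            ∑ s : Fin d → Bool,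
              spec (∑ i : Fin d,
                (if s i then (1 : ℝ) else -1) • Matrix.vecMulVec (y i) (y i)) ^ p)
          ^ (1 / p)
        ≤ C₀ * Real.sqrt (p + Real.log k) *
            (Finset.univ.fold max 0 (fun i : Fin d => Real.sqrt (∑ j, (y i j) ^ 2))) *
            Real.sqrt (spec (∑ i : Fin d, Matrix.vecMulVec (y i) (y i))) := by
  refine ⟨2 * Real.exp (1 / 2), by positivity, fun k d y p hp => ?_⟩
  set M := Finset.univ.fold max 0 (fun i : Fin d => Real.sqrt (∑ j, (y i j) ^ 2)) with hMdef
  set S := spec (∑ i : Fin d, Matrix.vecMulVec (y i) (y i)) with hS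
  have hM0 : 0 ≤ M := (Finset.le_fold_max 0).2 (Or.inl le_rfl)
  have hM : ∀ i, dotProduct (y i) (y i) ≤ M ^ 2 := by
    intro i
    have h1 : Real.sqrt (∑ j, (y i j) ^ 2) ≤ M :=
      (Finset.le_fold_max _).2 (Or.inr ⟨i, Finset.mem_univ i, le_rfl⟩)
    have h2 : dotProduct (y i) (y i) = ∑ j, (y i j) ^ 2 := by simp [dotProduct, sq]
    rw [h2, ← Real.sq_sqrt (Finset.sum_nonneg fun j _ => sq_nonneg (y i j))]
    exact pow_le_pow_left₀ (Real.sqrt_nonneg _) h1 2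
  have hS0 : 0 ≤ S := norm_nonneg _
  have hlog : 0 ≤ Real.log k := Real.log_natCast_nonneg k
  set t := p + Real.log k with ht
  set N := ⌈t⌉₊ with hN
  have hN1 : t ≤ N := Nat.le_ceil t
  have hN2 : (N : ℝ) ≤ 2 * t := by
    have := Nat.ceil_lt_add_one (show 0 ≤ t by linarith)
    linarith
  have hNpos : (0 : ℝ) < N := by linarith
  have hN0 : 1 ≤ N := by exact_mod_cast hNpos
  have hj := rud_jensen (fun s : Fin d → Bool => spec (rudX y s)) (fun s => norm_nonneg _)
    (2 ^ d) (by simp) p ((2 * N : ℕ) : ℝ) (by linarith) (by push_cast; linarith)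
  refine le_trans hj ?_
  simp only [Real.rpow_natCast]
  have hb : (2 ^ d : ℝ)⁻¹ * ∑ s : Fin d → Bool, spec (rudX y s) ^ (2 * N)
      ≤ k * (2 * N * (M ^ 2 * S)) ^ N := by
    have h1 := rud_moment y M hM N N le_rfl
    have h2 : ∑ s : Fin d → Bool, spec (rudX y s) ^ (2 * N)
      ≤ ∑ s : Fin d → Bool, (rudX y s ^ (2 * N)).trace :=
      Finset.sum_le_sum fun s _ => rud_spec_pow _ (rudX_symm y s) N hN0
    rw [inv_mul_le_iff₀ (by positivity)]
    linarith
  have hk : (k : ℝ) ≤ Real.exp N := by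
    rcases Nat.eq_zero_or_pos k with h | h
    · rw [h]; simp; positivity
    · rw [← Real.exp_log (show (0 : ℝ) < k by exact_mod_cast h)]
      exact Real.exp_le_exp.2 (by linarith)
  set R := 2 * Real.exp (1 / 2) * Real.sqrt t * M * Real.sqrt S with hR
  have hR0 : 0 ≤ R := by positivity
  have hR2 : R ^ 2 = Real.exp 1 * (4 * t * (M ^ 2 * S)) := by
    rw [hR, mul_pow, mul_pow, mul_pow, mul_pow, Real.sq_sqrt hS0, Real.sq_sqrt (by linarith),
      ← Real.exp_nat_mul]
    norm_num
    ring
  have hb2 : (2 ^ d : ℝ)⁻¹ * ∑ s : Fin d → Bool, spec (rudX y s) ^ (2 * N) ≤ R ^ (2 * N) := by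
    refine hb.trans ?_
    rw [pow_mul, hR2, mul_pow (Real.exp 1), ← Real.exp_nat_mul, mul_one]
    have : 2 * N * (M ^ 2 * S) ≤ 4 * t * (M ^ 2 * S) := by
      refine mul_le_mul_of_nonneg_right ?_ (by positivity)
      linarith
    gcongr
  have hl0 : 0 ≤ (2 ^ d : ℝ)⁻¹ * ∑ s : Fin d → Bool, spec (rudX y s) ^ (2 * N) :=
    mul_nonneg (by positivity) (Finset.sum_nonneg fun s _ => pow_nonneg (norm_nonneg _) _)
  refine (Real.rpow_le_rpow hl0 hb2 (by positivity)).trans (le_of_eq ?_)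
  rw [one_div, Real.pow_rpow_inv_natCast hR0 (by omega)]
end
end

section
/- Order statistics lemma: Let a₁ ≥ a₂ ≥ … ≥ a_n ≥ 0 and let δ₁,…,δ_n be independent Bernoulli random variables with P(δ_j = 1) = δ where δ > 2/n. Set n(δ) = e + ∑_j δ_j. Then (δ/(4e))·√(log δn)·∑_{j≤1/δ} a_j ≤ E[√(log n(δ)) · max_{j≤n} δ_j a_j] ≤ 4δ·√(log δn)·∑_{j≤1/δ} a_j. -/
open scoped Classical
noncomputable section

namespace OrdStat

/-- weight of an outcome -/
def wt {n : ℕ} (δ : ℝ) (s : Fin n → Bool) : ℝ := ∏ i, (if s i then δ else 1 - δ)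

/-- expectation -/
def ex {n : ℕ} (δ : ℝ) (g : (Fin n → Bool) → ℝ) : ℝ := ∑ s, wt δ s * g s

/-- indicator -/
def ind (b : Bool) : ℝ := if b then 1 else 0

/-- number of successes -/
def cnt {n : ℕ} (s : Fin n → Bool) : ℝ := ∑ j, ind (s j)

theorem wt_eq {n : ℕ} (δ : ℝ) (s : Fin n → Bool) :
    δ ^ (Finset.univ.filter (fun j => s j = true)).card *
      (1 - δ) ^ (n - (Finset.univ.filter (fun j => s j = true)).card) = wt δ s := by
  unfold wt
  rw [Finset.prod_ite, Finset.prod_const, Finset.prod_const]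
  congr 2
  have := Finset.card_filter_add_card_filter_not (s := (Finset.univ : Finset (Fin n))) (fun j => s j = true)
  simp only [Finset.card_univ, Fintype.card_fin] at this
  omega

theorem cnt_eq {n : ℕ} (s : Fin n → Bool) :
    ((Finset.univ.filter (fun j => s j = true)).card : ℝ) = cnt s := by
  unfold cnt ind
  simp

theorem wt_nonneg {n : ℕ} {δ : ℝ} (h0 : 0 ≤ δ) (h1 : δ ≤ 1) (s : Fin n → Bool) : 0 ≤ wt δ s := by
  unfold wt
  apply Finset.prod_nonneg
  intro i _
  split_ifs <;> linarith

theorem ex_prod {n : ℕ} (δ : ℝ) (g : Fin n → Bool → ℝ) :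
    ex δ (fun s => ∏ i, g i (s i)) = ∏ i, (δ * g i true + (1 - δ) * g i false) := by
  unfold ex wt
  have h := Finset.prod_univ_sum (fun _ : Fin n => (Finset.univ : Finset Bool))
    (fun i b => (if b then δ else 1 - δ) * g i b)
  simp only [Fintype.univ_bool] at h
  have h2 : ∀ i : Fin n, ∑ b ∈ ({true, false} : Finset Bool), (if b = true then δ else 1 - δ) * g i b
    = δ * g i true + (1 - δ) * g i false := by intro i; simp
  simp only [h2] at h
  rw [h]
  have h3 : (Fintype.piFinset fun _ : Fin n => ({true, false} : Finset Bool)) = Finset.univ := by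
    ext s; simp
  rw [h3]
  refine Finset.sum_congr rfl fun s _ => ?_
  rw [Finset.prod_mul_distrib]

theorem ex_ind {n : ℕ} (δ : ℝ) (T U : Finset (Fin n)) (hTU : Disjoint T U) :
    ex δ (fun s => (∏ i ∈ T, ind (s i)) * ∏ i ∈ U, (1 - ind (s i)))
      = δ ^ T.card * (1 - δ) ^ U.card := by
  have h := ex_prod δ (fun (i : Fin n) b => (if i ∈ T then ind b else 1) * (if i ∈ U then 1 - ind b else 1))
  simp only [Finset.prod_mul_distrib, Finset.prod_ite_mem, Finset.univ_inter] at h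
  rw [h]
  have h2 : ∀ i : Fin n, (δ * ((if i ∈ T then ind true else 1) * (if i ∈ U then 1 - ind true else 1)) +
      (1 - δ) * ((if i ∈ T then ind false else 1) * (if i ∈ U then 1 - ind false else 1)))
      = (if i ∈ T then δ else 1) * (if i ∈ U then 1 - δ else 1) := by
    intro i
    by_cases hT : i ∈ T
    · have hU : i ∉ U := Finset.disjoint_left.mp hTU hT
      simp [hT, hU, ind]
    · by_cases hU : i ∈ U <;> simp [hT, hU, ind]
  simp only [h2, Finset.prod_mul_distrib, Finset.prod_ite_mem, Finset.univ_inter, Finset.prod_const]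

theorem ex_add {n : ℕ} (δ : ℝ) (f g : (Fin n → Bool) → ℝ) :
    ex δ (fun s => f s + g s) = ex δ f + ex δ g := by
  simp [ex, mul_add, Finset.sum_add_distrib]

theorem ex_smul {n : ℕ} (δ c : ℝ) (f : (Fin n → Bool) → ℝ) :
    ex δ (fun s => c * f s) = c * ex δ f := by
  simp only [ex, Finset.mul_sum]
  exact Finset.sum_congr rfl fun s _ => by ring

theorem ex_sum {n : ℕ} {ι : Type*} (T : Finset ι) (δ : ℝ) (f : ι → (Fin n → Bool) → ℝ) :
    ex δ (fun s => ∑ i ∈ T, f i s) = ∑ i ∈ T, ex δ (f i) := by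
  simp only [ex, Finset.mul_sum]
  exact Finset.sum_comm

theorem ex_mono {n : ℕ} {δ : ℝ} (h0 : 0 ≤ δ) (h1 : δ ≤ 1) {f g : (Fin n → Bool) → ℝ}
    (h : ∀ s, f s ≤ g s) : ex δ f ≤ ex δ g :=
  Finset.sum_le_sum fun s _ => mul_le_mul_of_nonneg_left (h s) (wt_nonneg h0 h1 s)

theorem ex_one {n : ℕ} (δ : ℝ) : ex δ (fun _ : Fin n → Bool => 1) = 1 := by
  have := ex_ind (n := n) δ ∅ ∅ (by simp)
  simpa using this

theorem ex_single {n : ℕ} (δ : ℝ) (j : Fin n) : ex δ (fun s => ind (s j)) = δ := by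
  have := ex_ind (n := n) δ {j} ∅ (by simp)
  simpa using this

theorem ex_pair {n : ℕ} {δ : ℝ} (j k : Fin n) (h : j ≠ k) :
    ex δ (fun s => ind (s j) * ind (s k)) = δ ^ 2 := by
  have := ex_ind (n := n) δ {j, k} ∅ (by simp)
  simpa [Finset.prod_pair h, Finset.card_pair h] using this

theorem ind_sq (b : Bool) : ind b * ind b = ind b := by cases b <;> simp [ind]
theorem ind_nonneg (b : Bool) : 0 ≤ ind b := by cases b <;> simp [ind]
theorem ind_le (b : Bool) : ind b ≤ 1 := by cases b <;> simp [ind]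

theorem cnt_nonneg {n : ℕ} (s : Fin n → Bool) : 0 ≤ cnt s :=
  Finset.sum_nonneg fun _ _ => ind_nonneg _

theorem ex_cnt {n : ℕ} (δ : ℝ) : ex δ (fun s : Fin n → Bool => cnt s) = δ * n := by
  unfold cnt
  rw [ex_sum]
  simp [ex_single, mul_comm]

theorem ex_ind_cnt {n : ℕ} {δ : ℝ} (h0 : 0 ≤ δ) (j : Fin n) :
    ex δ (fun s => ind (s j) * cnt s) ≤ δ * (1 + δ * n) := by
  unfold cnt
  simp only [Finset.mul_sum]
  rw [ex_sum]
  have : ∀ k : Fin n, ex δ (fun s => ind (s j) * ind (s k)) ≤ (if k = j then δ else 0) + δ ^ 2 := by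
    intro k
    by_cases h : k = j
    · subst h
      simp only [ind_sq, ex_single, if_true]
      nlinarith [sq_nonneg δ]
    · rw [ex_pair j k (Ne.symm h)]; simp [h]
  refine (Finset.sum_le_sum fun k _ => this k).trans ?_
  rw [Finset.sum_add_distrib]
  simp
  nlinarith

theorem ex_cnt_sq {n : ℕ} {δ : ℝ} (h0 : 0 ≤ δ) :
    ex δ (fun s : Fin n → Bool => cnt s * cnt s) ≤ δ * n * (1 + δ * n) := by
  have : (fun s : Fin n → Bool => cnt s * cnt s) = fun s => ∑ j, ind (s j) * cnt s := by
    funext s; rw [← Finset.sum_mul]; rfl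
  rw [this, ex_sum]
  refine (Finset.sum_le_sum fun k _ => ex_ind_cnt h0 k).trans ?_
  simp
  nlinarith

/-- the maximum -/
def mx {n : ℕ} (a : Fin n → ℝ) (s : Fin n → Bool) : ℝ :=
  Finset.univ.fold max 0 (fun j : Fin n => if s j then a j else 0)

/-- the root-log factor -/
def fl {n : ℕ} (s : Fin n → Bool) : ℝ := Real.sqrt (Real.log (Real.exp 1 + cnt s))

theorem mx_le {n : ℕ} {a : Fin n → ℝ} {s : Fin n → Bool} {c : ℝ} (hc : 0 ≤ c)
    (h : ∀ j, s j = true → a j ≤ c) : mx a s ≤ c := by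
  unfold mx
  rw [Finset.fold_max_le]
  refine ⟨hc, fun j _ => ?_⟩
  split_ifs with hj
  · exact h j hj
  · exact hc

theorem mx_nonneg {n : ℕ} (a : Fin n → ℝ) (s : Fin n → Bool) : 0 ≤ mx a s := by
  unfold mx
  rw [Finset.le_fold_max]
  exact Or.inl le_rfl

theorem le_mx {n : ℕ} (a : Fin n → ℝ) (s : Fin n → Bool) (j : Fin n) (h : s j = true) :
    a j ≤ mx a s := by
  unfold mx
  rw [Finset.le_fold_max]
  exact Or.inr ⟨j, Finset.mem_univ _, by simp [h]⟩

theorem ind_mono : Monotone ind := by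
  intro a b h
  cases a <;> cases b <;> first | exact absurd h (by decide) | simp [ind]

theorem cnt_mono {n : ℕ} : Monotone (cnt : (Fin n → Bool) → ℝ) := by
  intro s t h
  exact Finset.sum_le_sum fun i _ => ind_mono (h i)

theorem fl_mono {n : ℕ} : Monotone (fl : (Fin n → Bool) → ℝ) := by
  intro s t h
  unfold fl
  apply Real.sqrt_le_sqrt
  apply Real.log_le_log
  · have := cnt_nonneg s; positivity
  · have := cnt_mono h; linarith

theorem mx_mono {n : ℕ} {a : Fin n → ℝ} : Monotone (mx a) := by
  intro s t h
  apply mx_le (mx_nonneg _ _)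
  intro j hj
  apply le_mx
  have := h j
  rw [hj] at this
  exact top_le_iff.mp this

theorem wt_lat {n : ℕ} (δ : ℝ) (s t : Fin n → Bool) :
    wt δ s * wt δ t = wt δ (s ⊓ t) * wt δ (s ⊔ t) := by
  unfold wt
  rw [← Finset.prod_mul_distrib, ← Finset.prod_mul_distrib]
  refine Finset.prod_congr rfl fun i _ => ?_
  change _ = (if (s i ⊓ t i) = true then δ else 1 - δ) * (if (s i ⊔ t i) = true then δ else 1 - δ)
  generalize s i = x
  generalize t i = y
  cases x <;> cases y <;> simp [mul_comm]

theorem harris {n : ℕ} {δ : ℝ} (h0 : 0 ≤ δ) (h1 : δ ≤ 1) (a : Fin n → ℝ) :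
    ex δ (fl (n := n)) * ex δ (mx a) ≤ ex δ (fun s => fl s * mx a s) := by
  have h := fkg (fl (n := n)) (mx a) (wt δ) (fun s => wt_nonneg h0 h1 s)
    (fun s => Real.sqrt_nonneg _) (fun s => mx_nonneg a s) fl_mono mx_mono
    (fun s t => (wt_lat δ s t).le)
  have h2 : ∑ s : Fin n → Bool, wt δ s = 1 := by
    have := ex_one (n := n) δ
    simpa [ex] using this
  rw [h2, one_mul] at h
  exact h

theorem pow_lower {δ : ℝ} (h0 : 0 < δ) (h1 : δ ≤ 1) (j : ℕ) (hj : (j + 1 : ℝ) * δ ≤ 1) :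
    (Real.exp 1)⁻¹ ≤ (1 - δ) ^ j := by
  rcases Nat.eq_zero_or_pos j with rfl | hjp
  · rw [pow_zero]
    exact inv_le_one_of_one_le₀ (Real.one_le_exp zero_le_one)
  have hj1 : (1 : ℝ) ≤ j := by exact_mod_cast hjp
  have hd : 0 < 1 - δ := by nlinarith
  have e1 : (1 - δ)⁻¹ ≤ Real.exp (δ / (1 - δ)) := by
    have := Real.add_one_le_exp (δ / (1 - δ))
    have h3 : δ / (1 - δ) + 1 = (1 - δ)⁻¹ := by field_simp; ring
    linarith
  have e2 : ((1 - δ)⁻¹) ^ j ≤ Real.exp 1 := by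
    calc ((1 - δ)⁻¹) ^ j ≤ Real.exp (δ / (1 - δ)) ^ j := by gcongr
      _ = Real.exp (j * (δ / (1 - δ))) := by rw [← Real.exp_nat_mul]
      _ ≤ Real.exp 1 := by
        apply Real.exp_le_exp.mpr
        rw [← mul_div_assoc, div_le_one hd]; linarith
  rw [inv_pow] at e2
  exact inv_le_of_inv_le₀ (by positivity) e2

theorem mx_lower {n : ℕ} (a : Fin n → ℝ) (hpos : ∀ j, 0 ≤ a j) (T : Finset (Fin n))
    (s : Fin n → Bool) :
    ∑ j ∈ T, a j * (ind (s j) * ∏ i ∈ Finset.Iio j, (1 - ind (s i))) ≤ mx a s := by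
  by_cases h : ∃ j ∈ T, ind (s j) * ∏ i ∈ Finset.Iio j, (1 - ind (s i)) ≠ 0
  · obtain ⟨j, hjT, hj⟩ := h
    have hj1 : s j = true := by
      by_contra hc
      apply hj; simp [ind, hc]
    have hj2 : ∀ i < j, s i = false := by
      intro i hi
      by_contra hc
      apply hj
      rw [Finset.prod_eq_zero (Finset.mem_Iio.mpr hi), mul_zero]
      simp [ind, Bool.eq_true_of_not_eq_false hc]
    rw [Finset.sum_eq_single j]
    · have : ∏ i ∈ Finset.Iio j, (1 - ind (s i)) = 1 := by
        apply Finset.prod_eq_one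
        intro i hi
        simp [ind, hj2 i (Finset.mem_Iio.mp hi)]
      rw [this]
      simp only [ind, hj1, if_true, mul_one]
      exact le_mx a s j hj1
    · intro k _ hk
      rcases lt_or_gt_of_ne hk with h | h
      · simp [ind, hj2 k h]
      · rw [Finset.prod_eq_zero (Finset.mem_Iio.mpr h)]
        · simp
        · simp [ind, hj1]
    · intro h; exact absurd hjT h
  · push Not at h
    rw [Finset.sum_eq_zero]
    · exact mx_nonneg _ _
    · intro j hj; rw [h j hj, mul_zero]

theorem ex_mx_lower {n : ℕ} {δ : ℝ} (h0 : 0 < δ) (h1 : δ ≤ 1) (a : Fin n → ℝ)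
    (hpos : ∀ j, 0 ≤ a j) (T : Finset (Fin n)) (hT : ∀ j ∈ T, ((j : ℕ) + 1 : ℝ) * δ ≤ 1) :
    δ / Real.exp 1 * ∑ j ∈ T, a j ≤ ex δ (mx a) := by
  refine le_trans ?_ (ex_mono h0.le h1 (mx_lower a hpos T))
  rw [ex_sum, Finset.mul_sum]
  refine Finset.sum_le_sum fun j hj => ?_
  rw [ex_smul]
  have := ex_ind δ {j} (Finset.Iio j) (by simp)
  simp only [Finset.prod_singleton, Finset.card_singleton, pow_one, Fin.card_Iio] at this
  rw [this]
  have := pow_lower h0 h1 j (hT j hj)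
  rw [mul_comm (a j), div_eq_mul_inv]
  have h3 := hpos j
  gcongr

theorem fl_lower {n : ℕ} {L : ℝ} (hL : 2 < L) (s : Fin n → Bool) :
    Real.sqrt (Real.log L) * (L⁻¹ * cnt s + (-(L⁻¹ ^ 2 / 4)) * (cnt s * cnt s)) ≤ fl s := by
  unfold fl
  have hx := cnt_nonneg s
  set x := cnt s
  have hlog : 0 < Real.log L := Real.log_pos (by linarith)
  have hu : L⁻¹ * x + (-(L⁻¹ ^ 2 / 4)) * (x * x) = x / L - (x / L) ^ 2 / 4 := by
    field_simp; ring
  rw [hu]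
  have hu0 : 0 ≤ x / L := by positivity
  have hxu : x = x / L * L := by field_simp
  set u := x / L
  have he := Real.exp_pos 1
  have he1 : 1 < Real.exp 1 := by have := Real.add_one_lt_exp (x := 1) (by norm_num); linarith
  rcases le_total 1 u with h | h
  · calc _ ≤ Real.sqrt (Real.log L) * 1 := by
          gcongr; nlinarith [sq_nonneg (u / 2 - 1)]
      _ ≤ _ := by
          rw [mul_one]
          apply Real.sqrt_le_sqrt
          apply Real.log_le_log (by linarith)
          nlinarith
  · calc _ ≤ Real.sqrt (Real.log L) * u := by
          gcongr; nlinarith [sq_nonneg u]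
      _ = Real.sqrt (u ^ 2 * Real.log L) := by
          rw [Real.sqrt_mul (by positivity), Real.sqrt_sq hu0, mul_comm]
      _ ≤ _ := by
          apply Real.sqrt_le_sqrt
          have g := Real.geom_mean_le_arith_mean2_weighted hu0 (sub_nonneg.mpr h)
            (by linarith : (0:ℝ) ≤ L) zero_le_one (by ring)
          rw [Real.one_rpow, mul_one] at g
          have g2 : u * Real.log L ≤ Real.log (Real.exp 1 + x) := by
            rw [← Real.log_rpow (by linarith)]
            apply Real.log_le_log
            · positivity
            · linarith
          refine le_trans ?_ g2
          apply mul_le_mul_of_nonneg_right _ hlog.le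
          nlinarith

theorem ex_fl_lower {n : ℕ} {δ : ℝ} (h0 : 0 < δ) (h1 : δ ≤ 1) (hL : 2 < δ * n) :
    Real.sqrt (Real.log (δ * n)) / 4 ≤ ex δ (fl (n := n)) := by
  refine le_trans ?_ (ex_mono h0.le h1 (fl_lower hL))
  rw [ex_smul, ex_add, ex_smul, ex_smul, ex_cnt]
  have h := ex_cnt_sq (n := n) h0.le
  set L := δ * n
  set q := ex δ (fun s : Fin n → Bool => cnt s * cnt s)
  have hLp : 0 < L := by linarith
  have hs := Real.sqrt_nonneg (Real.log L)
  rw [inv_mul_cancel₀ hLp.ne']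
  have : L⁻¹ ^ 2 * q ≤ 3 / 2 := by
    calc L⁻¹ ^ 2 * q ≤ L⁻¹ ^ 2 * (L * (1 + L)) := by gcongr
      _ = (1 + L) / L := by field_simp
      _ ≤ 3 / 2 := by rw [div_le_iff₀ hLp]; linarith
  nlinarith

/-- Upper linear bound for the root-log factor. -/
theorem fl_upper {n : ℕ} {L : ℝ} (hL : 2 < L) :
    ∃ α β : ℝ, 0 ≤ β ∧ α + β * (1 + L) = Real.sqrt (Real.log (Real.exp 1 + 1 + L)) ∧
      ∀ s : Fin n → Bool, fl s ≤ α + β * cnt s := by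
  have he := Real.exp_pos 1
  set K := Real.exp 1 + 1 + L with hK
  have hKp : 1 < K := by linarith
  have hc : 0 < Real.log K := Real.log_pos hKp
  set r := Real.sqrt (Real.log K)
  have hr : 0 < r := Real.sqrt_pos.mpr hc
  have hr2 : r ^ 2 = Real.log K := Real.sq_sqrt hc.le
  refine ⟨r - (1 + L) / (2 * r * K), 1 / (2 * r * K), by positivity, by ring, fun s => ?_⟩
  have hx := cnt_nonneg s
  unfold fl
  set x := cnt s
  have hp : 0 < Real.exp 1 + x := by linarith
  have h1 : Real.log (Real.exp 1 + x) ≤ r ^ 2 + ((Real.exp 1 + x) / K - 1) := by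
    have := Real.log_le_sub_one_of_pos (x := (Real.exp 1 + x) / K) (by positivity)
    rw [Real.log_div (by positivity) (by positivity)] at this
    linarith
  have hl0 : 0 ≤ Real.log (Real.exp 1 + x) := by
    apply Real.log_nonneg
    have := Real.add_one_le_exp (1:ℝ); linarith
  have h2 : Real.sqrt (Real.log (Real.exp 1 + x)) ≤ (Real.log (Real.exp 1 + x) + r ^ 2) / (2 * r) := by
    rw [le_div_iff₀ (by positivity)]
    nlinarith [sq_nonneg (Real.sqrt (Real.log (Real.exp 1 + x)) - r), Real.sq_sqrt hl0]
  refine h2.trans ?_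
  rw [div_le_iff₀ (by positivity)]
  have : (r - (1 + L) / (2 * r * K) + 1 / (2 * r * K) * x) * (2 * r)
      = 2 * r ^ 2 + ((Real.exp 1 + x) / K - 1) := by
    field_simp
    rw [hK]; ring
  rw [this]; linarith

theorem mx_upper {n : ℕ} (a : Fin n → ℝ) (T : Finset (Fin n)) (b : ℝ) (hb : 0 ≤ b)
    (h1 : ∀ j ∈ T, b ≤ a j) (h2 : ∀ j ∉ T, a j ≤ b) (s : Fin n → Bool) :
    mx a s ≤ b + ∑ j ∈ T, (a j - b) * ind (s j) := by
  have hn : ∀ j ∈ T, 0 ≤ (a j - b) * ind (s j) := fun j hj =>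
    mul_nonneg (by linarith [h1 j hj]) (ind_nonneg _)
  have hs := Finset.sum_nonneg hn
  apply mx_le (by linarith)
  intro j hj
  by_cases hT : j ∈ T
  · have := Finset.single_le_sum hn hT
    simp only [hj, ind, if_true, mul_one] at this ⊢
    linarith
  · linarith [h2 j hT]

theorem ex_upper {n : ℕ} {δ : ℝ} (h0 : 0 < δ) (h1 : δ ≤ 1) (hL : 2 < δ * n) (a : Fin n → ℝ)
    (T : Finset (Fin n)) (b : ℝ) (hb : 0 ≤ b)
    (hb1 : ∀ j ∈ T, b ≤ a j) (hb2 : ∀ j ∉ T, a j ≤ b) :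
    ex δ (fun s => fl s * mx a s) ≤
      Real.sqrt (Real.log (Real.exp 1 + 1 + δ * n)) * (b + δ * ∑ j ∈ T, (a j - b)) := by
  obtain ⟨α, β, hβ, hαβ, hfl⟩ := fl_upper (n := n) hL
  have hf0 : ∀ s : Fin n → Bool, 0 ≤ fl s := fun s => Real.sqrt_nonneg _
  have key : ∀ s : Fin n → Bool, fl s * mx a s ≤
      b * (α * 1 + β * cnt s) +
        ∑ j ∈ T, (a j - b) * (α * ind (s j) + β * (ind (s j) * cnt s)) := by
    intro s
    have e : b * (α * 1 + β * cnt s) +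
        ∑ j ∈ T, (a j - b) * (α * ind (s j) + β * (ind (s j) * cnt s))
        = (α + β * cnt s) * (b + ∑ j ∈ T, (a j - b) * ind (s j)) := by
      rw [mul_add (α + β * cnt s), Finset.mul_sum]
      congr 1
      · ring
      · exact Finset.sum_congr rfl fun j _ => by ring
    rw [e]
    exact mul_le_mul (hfl s) (mx_upper a T b hb hb1 hb2 s) (mx_nonneg _ _) ((hf0 s).trans (hfl s))
  refine (ex_mono h0.le h1 key).trans ?_
  rw [ex_add, ex_sum, ex_smul, ex_add, ex_smul, ex_smul, ex_one, ex_cnt]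
  simp only [ex_smul, ex_add, ex_single]
  rw [← hαβ, mul_add (α + β * (1 + δ * n)), Finset.mul_sum, Finset.mul_sum]
  refine add_le_add ?_ (Finset.sum_le_sum fun j hj => ?_)
  · nlinarith [mul_nonneg hb hβ]
  · have e1 := ex_ind_cnt h0.le j
    have e2 := hb1 j hj
    have e3 : α * δ + β * ex δ (fun s => ind (s j) * cnt s) ≤ (α + β * (1 + δ * n)) * δ := by
      nlinarith [mul_le_mul_of_nonneg_left e1 hβ]
    calc _ ≤ (a j - b) * ((α + β * (1 + δ * n)) * δ) :=
          mul_le_mul_of_nonneg_left e3 (by linarith)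
      _ = _ := by ring

theorem log_bound {L : ℝ} (hL : 2 < L) :
    Real.sqrt (Real.log (Real.exp 1 + 1 + L)) ≤ 2 * Real.sqrt (Real.log L) := by
  have he : Real.exp 1 < 3 := by have := Real.exp_one_lt_d9; linarith
  have : Real.log (Real.exp 1 + 1 + L) ≤ 2 ^ 2 * Real.log L := by
    have h : (2:ℝ) ^ 2 * Real.log L = Real.log (L ^ 4) := by
      rw [Real.log_pow]; norm_num
    rw [h]
    apply Real.log_le_log
    · positivity
    · have : 4 < L ^ 2 := by nlinarith
      nlinarith
  calc _ ≤ Real.sqrt (2 ^ 2 * Real.log L) := Real.sqrt_le_sqrt this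
    _ = _ := by rw [Real.sqrt_mul (by positivity), Real.sqrt_sq (by norm_num)]

end OrdStat


/-- Order statistics lemma: for `a₁ ≥ … ≥ a_n ≥ 0` and independent Bernoulli
variables `δ_j` with success probability `δ > 2/n`, with
`n(δ) = e + ∑ δ_j`, one has
`(δ/4e)√(log δn) ∑_{j ≤ 1/δ} a_j ≤ E[√(log n(δ)) max_j δ_j a_j]
  ≤ 4δ√(log δn) ∑_{j ≤ 1/δ} a_j`.
The expectation is written out explicitly as a sum over the `2ⁿ` outcomes. -/
theorem order_statistics {n : ℕ} (a : Fin n → ℝ) (δ : ℝ)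
    (hmono : ∀ i j : Fin n, i ≤ j → a j ≤ a i) (hpos : ∀ j, 0 ≤ a j)
    (hδ : 2 / (n : ℝ) < δ) (hδ1 : δ ≤ 1) :
    (δ / (4 * Real.exp 1)) * Real.sqrt (Real.log (δ * n)) *
        (∑ j ∈ Finset.univ.filter (fun j : Fin n => (j : ℕ) < ⌊1 / δ⌋₊), a j)
      ≤ (∑ s : Fin n → Bool,
          δ ^ (Finset.univ.filter (fun j => s j)).card *
            (1 - δ) ^ (n - (Finset.univ.filter (fun j => s j)).card) *
            (Real.sqrt (Real.log (Real.exp 1 +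
                ((Finset.univ.filter (fun j => s j)).card : ℝ))) *
              Finset.univ.fold max 0 (fun j : Fin n => if s j then a j else 0)))
      ∧
    (∑ s : Fin n → Bool,
          δ ^ (Finset.univ.filter (fun j => s j)).card *
            (1 - δ) ^ (n - (Finset.univ.filter (fun j => s j)).card) *
            (Real.sqrt (Real.log (Real.exp 1 +
                ((Finset.univ.filter (fun j => s j)).card : ℝ))) *
              Finset.univ.fold max 0 (fun j : Fin n => if s j then a j else 0)))
      ≤ 4 * δ * Real.sqrt (Real.log (δ * n)) *
        (∑ j ∈ Finset.univ.filter (fun j : Fin n => (j : ℕ) < ⌊1 / δ⌋₊), a j) := by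
  rcases Nat.eq_zero_or_pos n with rfl | hn
  · simp
  have hn0 : (0:ℝ) < n := by exact_mod_cast hn
  have h0 : 0 < δ := lt_trans (by positivity) hδ
  have hL : 2 < δ * n := by rwa [div_lt_iff₀ hn0] at hδ
  have hE : (∑ s : Fin n → Bool,
          δ ^ (Finset.univ.filter (fun j => s j)).card *
            (1 - δ) ^ (n - (Finset.univ.filter (fun j => s j)).card) *
            (Real.sqrt (Real.log (Real.exp 1 +
                ((Finset.univ.filter (fun j => s j)).card : ℝ))) *
              Finset.univ.fold max 0 (fun j : Fin n => if s j then a j else 0)))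
      = OrdStat.ex δ (fun s => OrdStat.fl s * OrdStat.mx a s) := by
    unfold OrdStat.ex
    refine Finset.sum_congr rfl fun s _ => ?_
    rw [← OrdStat.wt_eq]
    simp only [OrdStat.fl]
    rw [← OrdStat.cnt_eq]
    rfl
  rw [hE]
  set m := ⌊1 / δ⌋₊ with hm
  have hmle : (m : ℝ) * δ ≤ 1 := by
    have : (m : ℝ) ≤ 1 / δ := Nat.floor_le (by positivity)
    rwa [le_div_iff₀ h0] at this
  have hmlt : 1 < ((m : ℝ) + 1) * δ := by
    have : 1 / δ < (m : ℝ) + 1 := Nat.lt_floor_add_one _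
    rwa [div_lt_iff₀ h0] at this
  have hm1 : 1 ≤ m := by
    rw [hm]; apply Nat.le_floor
    rw [Nat.cast_one, le_div_iff₀ h0]; linarith
  have hmn : m ≤ n := by
    have : (m : ℝ) < n := by
      by_contra hc
      push Not at hc
      nlinarith
    exact_mod_cast this.le
  set T := Finset.univ.filter (fun j : Fin n => (j : ℕ) < m) with hT
  have hA : 0 ≤ ∑ j ∈ T, a j := Finset.sum_nonneg fun j _ => hpos j
  have hs := Real.sqrt_nonneg (Real.log (δ * n))
  have hcard : T.card = m := by
    rw [hT, Fin.card_filter_val_lt]; omega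
  constructor
  · refine le_trans ?_ (OrdStat.harris h0.le hδ1 a)
    have e1 := OrdStat.ex_fl_lower h0 hδ1 hL
    have e2 := OrdStat.ex_mx_lower h0 hδ1 a hpos T (fun j hj => by
      have : (j : ℕ) + 1 ≤ m := (Finset.mem_filter.mp hj).2
      have : ((j : ℕ) + 1 : ℝ) ≤ m := by exact_mod_cast this
      nlinarith)
    calc _ = Real.sqrt (Real.log (δ * n)) / 4 * (δ / Real.exp 1 * ∑ j ∈ T, a j) := by
          field_simp
      _ ≤ _ := mul_le_mul e1 e2 (by positivity) (le_trans (by positivity) e1)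
  · set b := a ⟨m - 1, by omega⟩ with hb
    have hb1 : ∀ j ∈ T, b ≤ a j := fun j hj => hmono _ _ (by
      have : (j : ℕ) < m := (Finset.mem_filter.mp hj).2
      rw [Fin.le_def]; simp only; omega)
    have hb2 : ∀ j ∉ T, a j ≤ b := fun j hj => hmono _ _ (by
      have : ¬ (j : ℕ) < m := fun h => hj (Finset.mem_filter.mpr ⟨Finset.mem_univ _, h⟩)
      rw [Fin.le_def]; simp only; omega)
    have hb0 : 0 ≤ b := hpos _
    refine (OrdStat.ex_upper h0 hδ1 hL a T b hb0 hb1 hb2).trans ?_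
    have hlb := OrdStat.log_bound hL
    have hbA : m * b ≤ ∑ j ∈ T, a j := by
      have := Finset.card_nsmul_le_sum T a b hb1
      rwa [hcard, nsmul_eq_mul] at this
    have e : b + δ * ∑ j ∈ T, (a j - b) ≤ 2 * δ * ∑ j ∈ T, a j := by
      rw [Finset.sum_sub_distrib, Finset.sum_const, hcard, nsmul_eq_mul]
      have hmr : (1:ℝ) ≤ m := by exact_mod_cast hm1
      have e1 : b * (1 - m * δ) ≤ b * δ := mul_le_mul_of_nonneg_left (by linarith) hb0
      have e2 : b ≤ m * b := by nlinarith
      have e3 : δ * b ≤ δ * ∑ j ∈ T, a j := mul_le_mul_of_nonneg_left (e2.trans hbA) h0.le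
      nlinarith
    calc _ ≤ Real.sqrt (Real.log (Real.exp 1 + 1 + δ * n)) * (2 * δ * ∑ j ∈ T, a j) :=
          mul_le_mul_of_nonneg_left e (Real.sqrt_nonneg _)
      _ ≤ 2 * Real.sqrt (Real.log (δ * n)) * (2 * δ * ∑ j ∈ T, a j) :=
          mul_le_mul_of_nonneg_right hlb (by positivity)
      _ = _ := by ring
end
end
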